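/- Let μ be a signed Radon measure on the unit disk D with |μ|(D) < τ, and suppose u ∈ L¹(D) weakly solves −Δu = μ with ‖u‖_{L¹(D)} < γ. Then u ∈ W^{1,q}(D_{1/2}) for every q ∈ [1,2), and there is a constant C(q) depending only on q such that ‖∇u‖_{L^q(D_{1/2})} ≤ C(q)·(‖u‖_{L¹(D)} + |μ|(D)). -/

import Mathlib

open MeasureTheory Metric Set Filter
open scoped Topology ENNReal NNReal BigOperators

noncomputable section

abbrev E2 : Type := EuclideanSpace ℝ (Fin 2)

/-- Smooth compactly supported test function. -/
def IsTest (φ : E2 → ℝ) : Prop := ContDiff ℝ (⊤ : ℕ∞) φ ∧ HasCompactSupport φ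

/-- Euclidean Laplacian. -/
def lap (φ : E2 → ℝ) (x : E2) : ℝ :=
  ∑ i : Fin 2, fderiv ℝ (fun y => fderiv ℝ φ y (EuclideanSpace.single i (1:ℝ))) x
    (EuclideanSpace.single i (1:ℝ))

/-- Integral of a function against a signed measure. -/
def sInt (μ : SignedMeasure E2) (f : E2 → ℝ) : ℝ :=
  (∫ x, f x ∂μ.toJordanDecomposition.posPart) - ∫ x, f x ∂μ.toJordanDecomposition.negPart

/-- Total variation measure of a signed measure. -/
def tv (μ : SignedMeasure E2) : Measure E2 := μ.totalVariation

/-- `u` weakly solves `-Δ u = μ` on `Ω`. -/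
def WeakPoisson (Ω : Set E2) (u : E2 → ℝ) (μ : SignedMeasure E2) : Prop :=
  ∀ φ : E2 → ℝ, IsTest φ → tsupport φ ⊆ Ω →
    (∫ x in Ω, u x * lap φ x) = - sInt μ φ

/-- `du` is the weak gradient of `u` on `Ω`. -/
def IsWeakGrad (Ω : Set E2) (u : E2 → ℝ) (du : E2 → E2) : Prop :=
  ∀ φ : E2 → ℝ, IsTest φ → tsupport φ ⊆ Ω → ∀ i : Fin 2,
    (∫ x in Ω, u x * fderiv ℝ φ x (EuclideanSpace.single i (1:ℝ)))
      = - ∫ x in Ω, φ x * du x i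

/-- Piecewise C¹ curve on `[0,1]`. -/
def PiecewiseC1 (γ : ℝ → E2) : Prop :=
  ContinuousOn γ (Set.Icc 0 1) ∧
  ∃ (n : ℕ) (t : Fin (n + 1) → ℝ), StrictMono t ∧ t 0 = 0 ∧ t (Fin.last n) = 1 ∧
    ∀ i : Fin n, ContDiffOn ℝ 1 γ (Set.Icc (t i.castSucc) (t i.succ))

/-- Length of a curve in the conformal metric `e^{2u} g_euc`. -/
def clen (u : E2 → ℝ) (γ : ℝ → E2) : ℝ :=
  ∫ t in (0:ℝ)..1, Real.exp (u (γ t)) * ‖deriv γ t‖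

/-- Piecewise C¹ curves in `Ω` from `x` to `y`. -/
def pathsIn (Ω : Set E2) (x y : E2) : Set (ℝ → E2) :=
  {γ | PiecewiseC1 γ ∧ γ 0 = x ∧ γ 1 = y ∧ ∀ t ∈ Set.Icc (0:ℝ) 1, γ t ∈ Ω}

/-- The distance of the conformal metric `e^{2u} g_euc` on `Ω`. -/
def gdist (u : E2 → ℝ) (Ω : Set E2) (x y : E2) : ℝ :=
  sInf (clen u '' pathsIn Ω x y)

open scoped Convolution Pointwise

/-- The `i`-th partial derivative. -/
def pd (i : Fin 2) (f : E2 → ℝ) (x : E2) : ℝ :=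
  fderiv ℝ f x (EuclideanSpace.single i (1:ℝ))

/-- Convolution of real functions on the plane. -/
def conv (f g : E2 → ℝ) : E2 → ℝ := f ⋆[ContinuousLinearMap.mul ℝ ℝ, volume] g

lemma conv_apply (f g : E2 → ℝ) (y : E2) : conv f g y = ∫ x, f (y - x) * g x :=
  convolution_mul_swap

lemma conv_apply' (f g : E2 → ℝ) (y : E2) : conv f g y = ∫ x, f x * g (y - x) := rfl

lemma lap_eq_sum_pd (f : E2 → ℝ) (x : E2) : lap f x = ∑ i, pd i (pd i f) x := rfl

lemma IsTest.continuous {f : E2 → ℝ} (hf : IsTest f) : Continuous f := hf.1.continuous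

lemma IsTest.pd {f : E2 → ℝ} (hf : IsTest f) (i : Fin 2) : IsTest (pd i f) :=
  ⟨(hf.1.fderiv_right (m := (⊤ : ℕ∞)) (by simp)).clm_apply contDiff_const,
    hf.2.fderiv_apply (𝕜 := ℝ) _⟩

lemma tsupport_pd_subset (f : E2 → ℝ) (i : Fin 2) : tsupport (pd i f) ⊆ tsupport f :=
  tsupport_fderiv_apply_subset ℝ _

lemma IsTest.locallyIntegrable {f : E2 → ℝ} (hf : IsTest f) : LocallyIntegrable f volume :=
  hf.continuous.locallyIntegrable

lemma IsTest.contDiff_one {f : E2 → ℝ} (hf : IsTest f) : ContDiff ℝ 1 f :=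
  hf.1.of_le (by exact_mod_cast le_top)

lemma IsTest.conv {f g : E2 → ℝ} (hf : IsTest f) (hg : IsTest g) : IsTest (conv f g) :=
  ⟨hf.2.contDiff_convolution_left (ContinuousLinearMap.mul ℝ ℝ) hf.1 hg.locallyIntegrable,
    HasCompactSupport.convolution (ContinuousLinearMap.mul ℝ ℝ) hf.2 hg.2⟩

lemma pd_conv_right {f g : E2 → ℝ} (hf : LocallyIntegrable f volume) (hg : IsTest g) (i : Fin 2) :
    pd i (conv f g) = conv f (pd i g) := by
  funext x
  have h := hg.2.hasFDerivAt_convolution_right (ContinuousLinearMap.mul ℝ ℝ) hf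
    hg.contDiff_one x
  unfold pd conv
  rw [h.fderiv, convolution_precompR_apply _ hf (hg.2.fderiv ℝ)
    (hg.contDiff_one.continuous_fderiv one_ne_zero)]

lemma conv_comm (f g : E2 → ℝ) : conv f g = conv g f := by
  funext y
  rw [conv_apply, conv_apply']
  simp_rw [mul_comm]

lemma pd_conv_left {f g : E2 → ℝ} (hf : IsTest f) (hg : LocallyIntegrable g volume) (i : Fin 2) :
    pd i (conv f g) = conv (pd i f) g := by
  rw [conv_comm, pd_conv_right hg hf, conv_comm]

lemma conv_pd_comm {f g : E2 → ℝ} (hf : IsTest f) (hg : IsTest g) (i : Fin 2) :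
    conv f (pd i g) = conv (pd i f) g := by
  rw [← pd_conv_right hf.locallyIntegrable hg, pd_conv_left hf hg.locallyIntegrable]

lemma lap_conv {f g : E2 → ℝ} (hf : IsTest f) (hg : IsTest g) :
    lap (conv f g) = conv (lap f) g := by
  funext x
  rw [lap_eq_sum_pd]
  simp_rw [pd_conv_left hf hg.locallyIntegrable, pd_conv_left (hf.pd _) hg.locallyIntegrable,
    conv_apply, lap_eq_sum_pd, Finset.sum_mul]
  rw [integral_finsetSum]
  intro i _
  have := (((hf.pd i).pd i).2.convolutionExists_left (ContinuousLinearMap.mul ℝ ℝ)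
    ((hf.pd i).pd i).continuous hg.locallyIntegrable x).integrable_swap
  simpa using this

lemma tsupport_conv_subset {f g : E2 → ℝ} {r s : ℝ} (hf : tsupport f ⊆ closedBall 0 r)
    (hg : HasCompactSupport g) (hgs : tsupport g ⊆ ball 0 s) :
    tsupport (conv f g) ⊆ ball 0 (s + r) := by
  have h1 : tsupport (conv f g) ⊆ closedBall (0:E2) r + tsupport g := by
    refine closure_minimal ?_ ((isCompact_closedBall _ _).add hg).isClosed
    refine (support_convolution_subset _).trans (add_subset_add ?_ (subset_tsupport g))
    exact (subset_tsupport f).trans hf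
  refine h1.trans ?_
  rintro _ ⟨a, ha, b, hb, rfl⟩
  have hb' := hgs hb
  simp only [mem_closedBall, mem_ball, dist_zero_right] at *
  linarith [norm_add_le a b]

lemma setIntegral_of_tsupport_subset {φ : E2 → ℝ} {Ω : Set E2} (h : tsupport φ ⊆ Ω)
    (ν : Measure E2) : ∫ x in Ω, φ x ∂ν = ∫ x, φ x ∂ν :=
  setIntegral_eq_integral_of_forall_compl_eq_zero
    fun _ hx => image_eq_zero_of_notMem_tsupport fun h' => hx (h h')

lemma WeakPoisson.conv {u : E2 → ℝ} {μ : SignedMeasure E2} (h : WeakPoisson (ball 0 1) u μ)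
    {f φ : E2 → ℝ} {δ : ℝ} (hf : IsTest f) (hfs : tsupport f ⊆ closedBall 0 δ)
    (hφ : IsTest φ) (hφs : tsupport φ ⊆ ball 0 (1 - δ)) :
    ∫ x in ball 0 1, u x * conv (lap f) φ x =
      (∫ x in ball 0 1, conv f φ x ∂μ.toJordanDecomposition.negPart) -
        ∫ x in ball 0 1, conv f φ x ∂μ.toJordanDecomposition.posPart := by
  have hs : tsupport (_root_.conv f φ) ⊆ ball 0 1 := by
    simpa using tsupport_conv_subset hfs hφ.2 hφs
  have := h _ (hf.conv hφ) hs
  rw [lap_conv hf hφ] at this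
  rw [this, sInt, setIntegral_of_tsupport_subset hs, setIntegral_of_tsupport_subset hs]
  ring

/-- The Riesz kernel `‖z‖⁻¹` truncated to the unit disk. -/
def riesz (z : E2) : ℝ := (closedBall (0:E2) 1).indicator (fun z => ‖z‖⁻¹) z

lemma riesz_nonneg (z : E2) : 0 ≤ riesz z :=
  indicator_nonneg (fun _ _ => by positivity) _

lemma measurable_riesz : Measurable riesz :=
  (measurable_norm.inv).indicator measurableSet_closedBall

lemma integrable_riesz_rpow {q : ℝ} (hq : q ∈ Ico (1:ℝ) 2) :
    Integrable (fun z => riesz z ^ q) volume := by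
  have h : IntegrableOn (fun z => riesz z ^ q) (ball (0:E2) 2) volume := by
    refine integrableOn_ball_of_norm_le_rpow (C := 1) (α := q) (by simp) (by simpa using hq.2) ?_
      (measurable_riesz.pow_const q).aestronglyMeasurable
    refine Eventually.of_forall fun x => ?_
    rw [Real.norm_of_nonneg (Real.rpow_nonneg (riesz_nonneg x) q), one_mul,
      Real.rpow_neg (norm_nonneg x), ← Real.inv_rpow (norm_nonneg x)]
    exact Real.rpow_le_rpow (riesz_nonneg x)
      (indicator_le_self' (fun _ _ => by positivity) x) (by linarith [hq.1])
  refine (integrableOn_iff_integrable_of_support_subset fun x hx => ?_).1 h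
  by_contra hx'
  refine hx ?_
  have : x ∉ closedBall (0:E2) 1 := fun h' =>
    hx' (closedBall_subset_ball (by norm_num) h')
  simp only [riesz, indicator_of_notMem this]
  exact Real.zero_rpow (by linarith [hq.1])

lemma integrable_riesz : Integrable riesz volume := by
  simpa using integrable_riesz_rpow (q := 1) (by norm_num)

lemma integrable_of_le_riesz {k : E2 → ℝ} {K : ℝ} (hk : AEStronglyMeasurable k volume)
    (hb : ∀ᵐ z, |k z| ≤ K * riesz z) : Integrable k volume :=
  (integrable_riesz.const_mul K).mono' hk hb

lemma abs_conv_le {k ψ : E2 → ℝ} {K B : ℝ} (hb : ∀ᵐ z, |k z| ≤ K * riesz z)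
    (hψ : ∀ z, |ψ z| ≤ B) (y : E2) :
    |conv k ψ y| ≤ ∫ z, K * riesz z * B := by
  rw [conv_apply', ← Real.norm_eq_abs]
  refine norm_integral_le_of_norm_le ((integrable_riesz.const_mul K).mul_const B) ?_
  filter_upwards [hb] with z hz
  rw [norm_mul]
  exact mul_le_mul hz (hψ _) (norm_nonneg _) ((abs_nonneg _).trans hz)

lemma tendsto_conv {ι : Type*} {l : Filter ι} [l.IsCountablyGenerated] {k : ι → E2 → ℝ}
    {k₀ ψ : E2 → ℝ} {K B : ℝ} (hk : ∀ᶠ n in l, AEStronglyMeasurable (k n) volume)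
    (hb : ∀ᶠ n in l, ∀ᵐ z, |k n z| ≤ K * riesz z)
    (hlim : ∀ᵐ z, Tendsto (fun n => k n z) l (𝓝 (k₀ z)))
    (hψc : Continuous ψ) (hψ : ∀ z, |ψ z| ≤ B) (y : E2) :
    Tendsto (fun n => conv (k n) ψ y) l (𝓝 (conv k₀ ψ y)) := by
  simp_rw [conv_apply']
  refine tendsto_integral_filter_of_dominated_convergence (fun z => K * riesz z * B) ?_ ?_
    ((integrable_riesz.const_mul K).mul_const B) ?_
  · filter_upwards [hk] with n hn
    exact hn.mul (by fun_prop : Continuous fun x => ψ (y - x)).aestronglyMeasurable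
  · filter_upwards [hb] with n hn
    filter_upwards [hn] with z hz
    rw [norm_mul]
    exact mul_le_mul hz (hψ _) (norm_nonneg _) ((abs_nonneg _).trans hz)
  · filter_upwards [hlim] with z hz
    exact hz.mul_const _

lemma tendsto_integral_mul_of_bounded {ι : Type*} {l : Filter ι} [l.IsCountablyGenerated]
    {ν : Measure E2} {w : E2 → ℝ} (hw : Integrable w ν) {a : ι → E2 → ℝ} {a₀ : E2 → ℝ} {M : ℝ}
    (hc : ∀ᶠ n in l, Continuous (a n)) (hM : ∀ᶠ n in l, ∀ y, |a n y| ≤ M)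
    (hlim : ∀ y, Tendsto (fun n => a n y) l (𝓝 (a₀ y))) :
    Tendsto (fun n => ∫ y, w y * a n y ∂ν) l (𝓝 (∫ y, w y * a₀ y ∂ν)) := by
  refine tendsto_integral_filter_of_dominated_convergence (fun y => |w y| * M) ?_ ?_
    (hw.abs.mul_const M) ?_
  · filter_upwards [hc] with n hn
    exact hw.1.mul hn.aestronglyMeasurable
  · filter_upwards [hM] with n hn
    refine Eventually.of_forall fun y => ?_
    rw [norm_mul]
    exact mul_le_mul_of_nonneg_left (hn y) (abs_nonneg _)
  · exact Eventually.of_forall fun y => (hlim y).const_mul _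

/-- The potential of the density `w` with respect to `ν`, for the kernel `k`. -/
def pot (k w : E2 → ℝ) (ν : Measure E2) (x : E2) : ℝ := ∫ y, w y * k (y - x) ∂ν

section Potential

variable {k w : E2 → ℝ} {ν : Measure E2}

lemma enorm_pot_le {K : ℝ} (hK : 0 ≤ K) (hb : ∀ z, |k z| ≤ K * riesz z) (x : E2) :
    ‖pot k w ν x‖ₑ ≤ ENNReal.ofReal K * ∫⁻ y, ‖w y‖ₑ * ENNReal.ofReal (riesz (y - x)) ∂ν := by
  rw [← lintegral_const_mul' _ _ ENNReal.ofReal_ne_top]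
  refine (enorm_integral_le_lintegral_enorm _).trans (lintegral_mono fun y => ?_)
  rw [enorm_mul, mul_left_comm, ← ENNReal.ofReal_mul hK]
  gcongr
  rw [Real.enorm_eq_ofReal_abs]
  exact ENNReal.ofReal_le_ofReal (hb _)

variable [SFinite ν]

lemma integrable_pot_integrand (hk : Integrable k volume) (hw : Integrable w ν) :
    Integrable (fun p : E2 × E2 => w p.2 * k (p.2 - p.1)) (volume.prod ν) := by
  simpa using hw.convolution_integrand (ContinuousLinearMap.mul ℝ ℝ) hk.comp_neg

lemma integrable_pot (hk : Integrable k volume) (hw : Integrable w ν) :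
    Integrable (pot k w ν) volume :=
  (integrable_pot_integrand hk hw).integral_prod_left

lemma integral_mul_conv (hk : Integrable k volume) (hw : Integrable w ν) {φ : E2 → ℝ} {B : ℝ}
    (hφ : Continuous φ) (hB : ∀ z, |φ z| ≤ B) :
    ∫ y, w y * conv k φ y ∂ν = ∫ x, φ x * pot k w ν x := by
  have h : Integrable (fun p : E2 × E2 => φ p.1 * (w p.2 * k (p.2 - p.1))) (volume.prod ν) :=
    (integrable_pot_integrand hk hw).bdd_mul (c := B)
      (by fun_prop : Continuous fun p : E2 × E2 => φ p.1).aestronglyMeasurable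
      (Eventually.of_forall fun p => hB p.1)
  simp_rw [pot, conv_apply, ← integral_const_mul]
  refine Eq.trans ?_ (integral_integral_swap h).symm
  refine integral_congr_ae (Eventually.of_forall fun y => integral_congr_ae
    (Eventually.of_forall fun x => ?_))
  simp only
  ring

end Potential

lemma lintegral_rpow_le_of_measure {α : Type*} [MeasurableSpace α] (κ : Measure α)
    {q : ℝ} (hq : 1 ≤ q) {f : α → ℝ≥0∞} (hf : AEMeasurable f κ) :
    (∫⁻ y, f y ∂κ) ^ q ≤ κ univ ^ (q - 1) * ∫⁻ y, f y ^ q ∂κ := by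
  rcases hq.eq_or_lt with rfl | hq1
  · simp
  have hpq : q.HolderConjugate (q / (q - 1)) := Real.HolderConjugate.conjExponent hq1
  have := ENNReal.lintegral_mul_le_Lp_mul_Lq κ hpq hf (aemeasurable_const (b := 1))
  have h0 : 0 ≤ q := by linarith
  calc (∫⁻ y, f y ∂κ) ^ q ≤ _ := ENNReal.rpow_le_rpow (by simpa using this) h0
    _ = _ := by
      rw [ENNReal.mul_rpow_of_nonneg _ _ h0, ← ENNReal.rpow_mul, ← ENNReal.rpow_mul]
      have h1 : q ≠ 0 := by linarith
      have h2 : q - 1 ≠ 0 := by linarith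
      rw [mul_comm]
      congr 2
      · field_simp
      · field_simp; simp

lemma lintegral_riesz_pot_rpow_le (κ : Measure E2) [SFinite κ] {q : ℝ} (hq : 1 ≤ q) :
    ∫⁻ x, (∫⁻ y, ENNReal.ofReal (riesz (y - x)) ∂κ) ^ q ≤
      κ univ ^ q * ∫⁻ z, ENNReal.ofReal (riesz z) ^ q := by
  have hm : Measurable fun z => ENNReal.ofReal (riesz z) := measurable_riesz.ennreal_ofReal
  have hm2 : Measurable fun p : E2 × E2 => ENNReal.ofReal (riesz (p.2 - p.1)) ^ q :=
    (hm.comp (measurable_snd.sub measurable_fst)).pow_const q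
  have hm3 : Measurable fun x : E2 => ∫⁻ y, ENNReal.ofReal (riesz (y - x)) ^ q ∂κ :=
    hm2.lintegral_prod_right'
  calc ∫⁻ x, (∫⁻ y, ENNReal.ofReal (riesz (y - x)) ∂κ) ^ q
      ≤ ∫⁻ x, κ univ ^ (q - 1) * ∫⁻ y, ENNReal.ofReal (riesz (y - x)) ^ q ∂κ :=
        lintegral_mono fun x => lintegral_rpow_le_of_measure κ hq
          (hm.comp (measurable_id.sub_const x)).aemeasurable
    _ = κ univ ^ (q - 1) * ∫⁻ y, ∫⁻ x, ENNReal.ofReal (riesz (y - x)) ^ q ∂volume ∂κ := by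
        rw [lintegral_const_mul _ hm3]
        congr 1
        exact lintegral_lintegral_swap hm2.aemeasurable
    _ = κ univ ^ (q - 1) * (κ univ * ∫⁻ z, ENNReal.ofReal (riesz z) ^ q) := by
        congr 1
        have : ∀ y : E2, ∫⁻ x, ENNReal.ofReal (riesz (y - x)) ^ q =
            ∫⁻ z, ENNReal.ofReal (riesz z) ^ q := fun y =>
          lintegral_sub_left_eq_self (fun z => ENNReal.ofReal (riesz z) ^ q) y
        simp_rw [this, lintegral_const, mul_comm]
    _ = _ := by
        rw [← mul_assoc]
        congr 1
        nth_rewrite 2 [← ENNReal.rpow_one (κ univ)]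
        rw [← ENNReal.rpow_add_of_nonneg _ _ (by linarith) zero_le_one]
        simp

/-- A smooth cutoff function on the line, equal to `1` up to `δ ^ 2 / 2` and to `0` from `δ ^ 2`. -/
def cutoff (δ t : ℝ) : ℝ := Real.smoothTransition (2 - 2 * t / δ ^ 2)

lemma contDiff_cutoff (δ : ℝ) : ContDiff ℝ (⊤ : ℕ∞) (cutoff δ) :=
  Real.smoothTransition.contDiff.comp (by fun_prop)

lemma cutoff_nonneg (δ t : ℝ) : 0 ≤ cutoff δ t := Real.smoothTransition.nonneg _

lemma cutoff_le_one (δ t : ℝ) : cutoff δ t ≤ 1 := Real.smoothTransition.le_one _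

lemma abs_cutoff_le_one (δ t : ℝ) : |cutoff δ t| ≤ 1 := by
  rw [abs_of_nonneg (cutoff_nonneg δ t)]
  exact cutoff_le_one δ t

lemma cutoff_eq_one {δ t : ℝ} (hδ : 0 < δ) (ht : t ≤ δ ^ 2 / 2) : cutoff δ t = 1 := by
  apply Real.smoothTransition.one_of_one_le
  have : 2 * t / δ ^ 2 ≤ 1 := by
    rw [div_le_one (by positivity)]
    linarith
  linarith

lemma cutoff_eq_zero {δ t : ℝ} (hδ : 0 < δ) (ht : δ ^ 2 ≤ t) : cutoff δ t = 0 := by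
  apply Real.smoothTransition.zero_of_nonpos
  have : 2 ≤ 2 * t / δ ^ 2 := by
    rw [le_div_iff₀ (by positivity)]
    linarith
  linarith

lemma deriv_cutoff_of_lt {δ t : ℝ} (hδ : 0 < δ) (ht : t < δ ^ 2 / 2) : deriv (cutoff δ) t = 0 := by
  have : cutoff δ =ᶠ[𝓝 t] fun _ => 1 := by
    filter_upwards [Iio_mem_nhds ht] with s hs using cutoff_eq_one hδ hs.le
  simp [this.deriv_eq]

lemma deriv_cutoff_of_gt {δ t : ℝ} (hδ : 0 < δ) (ht : δ ^ 2 < t) : deriv (cutoff δ) t = 0 := by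
  have : cutoff δ =ᶠ[𝓝 t] fun _ => 0 := by
    filter_upwards [Ioi_mem_nhds ht] with s hs using cutoff_eq_zero hδ (le_of_lt hs)
  simp [this.deriv_eq]

lemma hasDerivAt_cutoff (δ t : ℝ) : HasDerivAt (cutoff δ) (deriv (cutoff δ) t) t :=
  ((contDiff_cutoff δ).differentiable (by simp) t).hasDerivAt

/-- The radial profile, in the variable `t = ‖z‖ ^ 2`, of the truncated and regularised
logarithm. -/
def logProfile (δ r t : ℝ) : ℝ := ∫ s in (δ ^ 2)..t, cutoff δ s / (s + r ^ 2)

lemma continuousOn_cutoff_div (δ r : ℝ) :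
    ContinuousOn (fun s => cutoff δ s / (s + r ^ 2)) (Ioi (-r ^ 2)) :=
  (contDiff_cutoff δ).continuous.continuousOn.div (by fun_prop) fun s hs => by
    have : -r ^ 2 < s := hs
    linarith

lemma contDiffOn_cutoff_div (δ r : ℝ) :
    ContDiffOn ℝ (⊤ : ℕ∞) (fun s => cutoff δ s / (s + r ^ 2)) (Ioi (-r ^ 2)) :=
  (contDiff_cutoff δ).contDiffOn.div (by fun_prop) fun s hs => by
    have : -r ^ 2 < s := hs
    linarith

lemma hasDerivAt_logProfile {δ r t : ℝ} (hδ : 0 < δ) (ht : -r ^ 2 < t) :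
    HasDerivAt (logProfile δ r) (cutoff δ t / (t + r ^ 2)) t := by
  have hc := continuousOn_cutoff_div δ r
  have hmem : Ioi (-r ^ 2) ∈ 𝓝 t := Ioi_mem_nhds ht
  refine intervalIntegral.integral_hasDerivAt_right ?_
    (hc.stronglyMeasurableAtFilter isOpen_Ioi t ht) (hc.continuousAt hmem)
  refine (hc.mono fun s hs => ?_).intervalIntegrable
  have : min (δ ^ 2) t ≤ s := hs.1
  have h2 : -r ^ 2 < δ ^ 2 := by nlinarith [sq_nonneg r, pow_pos hδ 2]
  exact (lt_min h2 ht).trans_le this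

lemma contDiffOn_logProfile {δ : ℝ} (hδ : 0 < δ) (r : ℝ) :
    ContDiffOn ℝ (⊤ : ℕ∞) (logProfile δ r) (Ioi (-r ^ 2)) := by
  rw [contDiffOn_infty_iff_deriv_of_isOpen isOpen_Ioi]
  refine ⟨fun t ht => (hasDerivAt_logProfile hδ ht).differentiableAt.differentiableWithinAt, ?_⟩
  exact (contDiffOn_cutoff_div δ r).congr fun t ht => (hasDerivAt_logProfile hδ ht).deriv

lemma logProfile_eq_zero {δ r t : ℝ} (hδ : 0 < δ) (ht : δ ^ 2 ≤ t) : logProfile δ r t = 0 := by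
  unfold logProfile
  rw [intervalIntegral.integral_congr (g := fun _ => 0)]
  · simp
  · intro s hs
    rw [uIcc_of_le ht] at hs
    simp [cutoff_eq_zero hδ hs.1]

lemma abs_logProfile_sq_le {δ r x : ℝ} (hδ : 0 < δ) (hδ1 : δ ≤ 1) (hx : 0 < x) :
    |logProfile δ r (x ^ 2)| ≤ 2 * x⁻¹ := by
  rcases le_or_gt δ x with h | h
  · rw [logProfile_eq_zero hδ (by gcongr)]
    simp only [abs_zero]
    positivity
  have hx2 : 0 < x ^ 2 := by positivity
  have hle : x ^ 2 ≤ δ ^ 2 := by gcongr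
  have h0 : (0:ℝ) ∉ uIcc (x ^ 2) (δ ^ 2) := by
    rw [uIcc_of_le hle]
    exact fun h' => absurd h'.1 (not_le.2 hx2)
  have h1 : ‖∫ s in (x ^ 2)..(δ ^ 2), cutoff δ s / (s + r ^ 2)‖ ≤
      ∫ s in (x ^ 2)..(δ ^ 2), s⁻¹ := by
    refine intervalIntegral.norm_integral_le_of_norm_le hle ?_
      (intervalIntegral.intervalIntegrable_inv (fun s hs hs0 => h0 (hs0 ▸ hs)) continuousOn_id)
    refine Eventually.of_forall fun s hs => ?_
    have hs0 : 0 < s := hx2.trans hs.1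
    rw [norm_div, Real.norm_eq_abs, Real.norm_eq_abs, abs_of_pos (a := s + r ^ 2) (by positivity),
      div_eq_mul_inv]
    calc |cutoff δ s| * (s + r ^ 2)⁻¹ ≤ 1 * s⁻¹ := by
          gcongr
          · exact abs_cutoff_le_one δ s
          · nlinarith [sq_nonneg r]
      _ = s⁻¹ := one_mul _
  rw [logProfile, intervalIntegral.integral_symm, abs_neg]
  refine h1.trans ?_
  rw [integral_inv h0, ← div_pow, Real.log_pow]
  have h2 : Real.log (δ / x) ≤ x⁻¹ := by
    refine (Real.log_le_self (by positivity)).trans ?_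
    rw [div_eq_mul_inv]
    exact mul_le_of_le_one_left (by positivity) hδ1
  push_cast
  linarith

lemma tendsto_logProfile {δ t : ℝ} (hδ : 0 < δ) (ht : 0 < t) :
    Tendsto (fun r => logProfile δ r t) (𝓝[>] 0) (𝓝 (logProfile δ 0 t)) := by
  have hm : 0 < min (δ ^ 2) t := lt_min (by positivity) ht
  refine intervalIntegral.tendsto_integral_filter_of_dominated_convergence
    (fun _ => (min (δ ^ 2) t)⁻¹) ?_ ?_ (by simp) ?_
  · refine Eventually.of_forall fun r => Measurable.aestronglyMeasurable ?_
    exact (contDiff_cutoff δ).continuous.measurable.div (by fun_prop)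
  · refine Eventually.of_forall fun r => Eventually.of_forall fun s hs => ?_
    have hs' : min (δ ^ 2) t < s := hs.1
    have hs0 : 0 < s := hm.trans hs'
    rw [norm_div, Real.norm_eq_abs, Real.norm_eq_abs, abs_of_pos (a := s + r ^ 2) (by positivity),
      div_eq_mul_inv]
    calc |cutoff δ s| * (s + r ^ 2)⁻¹ ≤ 1 * (min (δ ^ 2) t)⁻¹ := by
          gcongr
          · exact abs_cutoff_le_one δ s
          · nlinarith [sq_nonneg r]
      _ = _ := one_mul _
  · refine Eventually.of_forall fun s hs => ?_
    have hs0 : 0 < s := hm.trans hs.1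
    have : ContinuousAt (fun r : ℝ => cutoff δ s / (s + r ^ 2)) 0 :=
      continuousAt_const.div (by fun_prop) (by simpa using hs0.ne')
    exact this.tendsto.mono_left nhdsWithin_le_nhds

lemma pd_comp_norm_sq {F : ℝ → ℝ} {F' : ℝ} {z : E2} (h : HasDerivAt F F' (‖z‖ ^ 2)) (i : Fin 2) :
    pd i (fun z => F (‖z‖ ^ 2)) z = 2 * z i * F' := by
  have h1 : HasFDerivAt (fun z : E2 => ‖z‖ ^ 2) (2 • innerSL ℝ z) z :=
    (hasStrictFDerivAt_norm_sq z).hasFDerivAt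
  unfold pd
  have h2 := (h.comp_hasFDerivAt z h1).fderiv
  simp only [Function.comp_def] at h2
  rw [h2]
  simp [EuclideanSpace.inner_single_right]
  ring

lemma pd_coord_mul_comp_norm_sq {F : ℝ → ℝ} {F' : ℝ} {z : E2} (h : HasDerivAt F F' (‖z‖ ^ 2))
    (i : Fin 2) :
    pd i (fun z => 2 * z i * F (‖z‖ ^ 2)) z = 2 * F (‖z‖ ^ 2) + 4 * z i ^ 2 * F' := by
  have h1 : HasFDerivAt (fun z : E2 => ‖z‖ ^ 2) (2 • innerSL ℝ z) z :=
    (hasStrictFDerivAt_norm_sq z).hasFDerivAt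
  have h3 : HasFDerivAt (fun z : E2 => z i) (EuclideanSpace.proj i : E2 →L[ℝ] ℝ) z :=
    (EuclideanSpace.proj i : E2 →L[ℝ] ℝ).hasFDerivAt
  unfold pd
  have h2 := ((h3.const_mul 2).mul (h.comp_hasFDerivAt z h1)).fderiv
  simp only [Function.comp_def] at h2
  erw [h2]
  simp [EuclideanSpace.inner_single_right]
  ring

/-- The truncated and regularised logarithm on the plane. -/
def regLog (δ r : ℝ) (z : E2) : ℝ := logProfile δ r (‖z‖ ^ 2)

lemma contDiff_regLog {δ r : ℝ} (hδ : 0 < δ) (hr : 0 < r) :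
    ContDiff ℝ (⊤ : ℕ∞) (regLog δ r) := by
  rw [← contDiffOn_univ]
  refine (contDiffOn_logProfile hδ r).comp (contDiff_norm_sq ℝ).contDiffOn fun z _ => ?_
  have : 0 < r ^ 2 := by positivity
  exact lt_of_lt_of_le (by linarith) (sq_nonneg ‖z‖)

lemma tsupport_subset_closedBall {f : E2 → ℝ} {δ : ℝ} (h : ∀ z, δ < ‖z‖ → f z = 0) :
    tsupport f ⊆ closedBall 0 δ := by
  refine closure_minimal (fun z hz => ?_) isClosed_closedBall
  by_contra h'
  exact hz (h z (by simpa using h'))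

lemma isTest_of_norm {f : E2 → ℝ} {δ : ℝ} (hf : ContDiff ℝ (⊤ : ℕ∞) f)
    (h : ∀ z, δ < ‖z‖ → f z = 0) : IsTest f :=
  ⟨hf, (isCompact_closedBall (0:E2) δ).of_isClosed_subset (isClosed_tsupport f)
    (tsupport_subset_closedBall h)⟩

lemma regLog_eq_zero {δ r : ℝ} (hδ : 0 < δ) {z : E2} (hz : δ < ‖z‖) : regLog δ r z = 0 :=
  logProfile_eq_zero hδ (by gcongr)

lemma isTest_regLog {δ r : ℝ} (hδ : 0 < δ) (hr : 0 < r) : IsTest (regLog δ r) :=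
  isTest_of_norm (contDiff_regLog hδ hr) fun _ => regLog_eq_zero hδ

lemma tsupport_regLog {δ : ℝ} (hδ : 0 < δ) (r : ℝ) : tsupport (regLog δ r) ⊆ closedBall 0 δ :=
  tsupport_subset_closedBall fun _ => regLog_eq_zero hδ

/-- The `i`-th partial derivative of `regLog δ r`. -/
def gradKernel (δ r : ℝ) (i : Fin 2) (z : E2) : ℝ :=
  2 * z i * (cutoff δ (‖z‖ ^ 2) / (‖z‖ ^ 2 + r ^ 2))

lemma pd_regLog {δ r : ℝ} (hδ : 0 < δ) (hr : 0 < r) (i : Fin 2) :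
    pd i (regLog δ r) = gradKernel δ r i := by
  funext z
  refine pd_comp_norm_sq (hasDerivAt_logProfile hδ ?_) i
  nlinarith [sq_nonneg ‖z‖, pow_pos hr 2]

/-- The approximate Dirac mass in the Laplacian of `regLog δ r`. -/
def massKernel (δ r : ℝ) (z : E2) : ℝ :=
  4 * cutoff δ (‖z‖ ^ 2) * r ^ 2 / (‖z‖ ^ 2 + r ^ 2) ^ 2

/-- The remainder in the Laplacian of `regLog δ r`. -/
def remKernel (δ r : ℝ) (z : E2) : ℝ :=
  4 * deriv (cutoff δ) (‖z‖ ^ 2) * (‖z‖ ^ 2 / (‖z‖ ^ 2 + r ^ 2))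

lemma lap_regLog {δ r : ℝ} (hδ : 0 < δ) (hr : 0 < r) :
    lap (regLog δ r) = fun z => massKernel δ r z + remKernel δ r z := by
  funext z
  have hpos : 0 < ‖z‖ ^ 2 + r ^ 2 := by positivity
  have h := (hasDerivAt_cutoff δ (‖z‖ ^ 2)).div
    ((hasDerivAt_id (‖z‖ ^ 2)).add_const (r ^ 2)) hpos.ne'
  simp only [id] at h
  have h2 := fun i => pd_coord_mul_comp_norm_sq h i
  rw [lap_eq_sum_pd]
  simp_rw [pd_regLog hδ hr]
  have h3 : ∀ i, pd i (gradKernel δ r i) z = _ := h2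
  rw [Fin.sum_univ_two, h3, h3]
  have hn : z 0 ^ 2 + z 1 ^ 2 = ‖z‖ ^ 2 := by
    rw [EuclideanSpace.real_norm_sq_eq, Fin.sum_univ_two]
  simp only [massKernel, remKernel, Pi.div_apply]
  have e : ∀ a b : ℝ, 2 * a + 4 * z 0 ^ 2 * b + (2 * a + 4 * z 1 ^ 2 * b) =
      4 * a + 4 * ‖z‖ ^ 2 * b := by
    intro a b
    rw [← hn]
    ring
  rw [e]
  field_simp
  ring

/-- The limit of `regLog δ r` as `r → 0`. -/
def logKernel (δ : ℝ) (z : E2) : ℝ := ({0}ᶜ : Set E2).indicator (regLog δ 0) z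

/-- The limit of `remKernel δ r` as `r → 0`. -/
def smoothKernel (δ : ℝ) (z : E2) : ℝ := 4 * deriv (cutoff δ) (‖z‖ ^ 2)

lemma riesz_of_norm_le_one {z : E2} (hz : ‖z‖ ≤ 1) : riesz z = ‖z‖⁻¹ :=
  indicator_of_mem (by simpa using hz) _

lemma ae_ne_zero : ∀ᵐ z : E2, z ≠ 0 := by
  simp [ae_iff]

lemma abs_regLog_le {δ : ℝ} (hδ : 0 < δ) (hδ1 : δ ≤ 1) (r : ℝ) {z : E2} (hz : z ≠ 0) :
    |regLog δ r z| ≤ 2 * riesz z := by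
  rcases le_or_gt ‖z‖ 1 with h | h
  · rw [riesz_of_norm_le_one h]
    exact abs_logProfile_sq_le hδ hδ1 (norm_pos_iff.2 hz)
  · rw [regLog_eq_zero hδ (hδ1.trans_lt h), abs_zero]
    linarith [riesz_nonneg z]

lemma abs_logKernel_le {δ : ℝ} (hδ : 0 < δ) (hδ1 : δ ≤ 1) (z : E2) :
    |logKernel δ z| ≤ 2 * riesz z := by
  rcases eq_or_ne z 0 with rfl | hz
  · simp [logKernel, riesz_nonneg]
  · rw [logKernel, indicator_of_mem (by simpa using hz)]
    exact abs_regLog_le hδ hδ1 0 hz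

lemma tendsto_regLog {δ : ℝ} (hδ : 0 < δ) {z : E2} (hz : z ≠ 0) :
    Tendsto (fun r => regLog δ r z) (𝓝[>] 0) (𝓝 (logKernel δ z)) := by
  rw [logKernel, indicator_of_mem (by simpa using hz)]
  exact tendsto_logProfile hδ (by positivity)

lemma eventually_pos : ∀ᶠ r : ℝ in 𝓝[>] 0, 0 < r := self_mem_nhdsWithin

lemma aestronglyMeasurable_logKernel {δ : ℝ} (hδ : 0 < δ) :
    AEStronglyMeasurable (logKernel δ) volume := by
  obtain ⟨ρ, hρ⟩ := exists_seq_tendsto (𝓝[>] (0:ℝ))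
  have hpos := hρ.eventually eventually_pos
  obtain ⟨N, hN⟩ := eventually_atTop.1 hpos
  refine aestronglyMeasurable_of_tendsto_ae atTop (f := fun n => regLog δ (ρ (n + N)))
    (fun n => (contDiff_regLog hδ (hN _ (by lia))).continuous.aestronglyMeasurable) ?_
  filter_upwards [ae_ne_zero] with z hz
  exact ((tendsto_regLog hδ hz).comp hρ).comp (tendsto_add_atTop_nat N)

lemma abs_coord_le (z : E2) (i : Fin 2) : |z i| ≤ ‖z‖ := by
  simpa using PiLp.norm_apply_le z i

lemma abs_gradKernel_le {δ : ℝ} (hδ : 0 < δ) (hδ1 : δ ≤ 1) (r : ℝ) (i : Fin 2) (z : E2) :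
    |gradKernel δ r i z| ≤ 2 * riesz z := by
  rcases eq_or_ne z 0 with rfl | hz
  · simp [gradKernel, riesz_nonneg]
  rcases le_or_gt ‖z‖ 1 with h | h
  · have hz' : 0 < ‖z‖ := norm_pos_iff.2 hz
    rw [riesz_of_norm_le_one h, gradKernel, abs_mul, abs_mul, abs_div, abs_two,
      abs_of_pos (a := ‖z‖ ^ 2 + r ^ 2) (by positivity)]
    calc 2 * |z i| * (|cutoff δ (‖z‖ ^ 2)| / (‖z‖ ^ 2 + r ^ 2))
        ≤ 2 * ‖z‖ * (1 / ‖z‖ ^ 2) := by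
          gcongr
          · exact abs_coord_le z i
          · exact abs_cutoff_le_one δ _
          · nlinarith [sq_nonneg r]
      _ = 2 * ‖z‖⁻¹ := by field_simp
  · have : cutoff δ (‖z‖ ^ 2) = 0 := cutoff_eq_zero hδ (by gcongr; linarith)
    simp only [gradKernel, this, zero_div, mul_zero, abs_zero]
    linarith [riesz_nonneg z]

lemma measurable_gradKernel (δ r : ℝ) (i : Fin 2) : Measurable (gradKernel δ r i) := by
  have h1 : Measurable fun z : E2 => z i := (EuclideanSpace.proj i : E2 →L[ℝ] ℝ).measurable
  have h2 : Measurable fun z : E2 => cutoff δ (‖z‖ ^ 2) :=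
    (contDiff_cutoff δ).continuous.measurable.comp (by fun_prop)
  exact (h1.const_mul 2).mul (h2.div (by fun_prop))

lemma tendsto_gradKernel (δ : ℝ) (i : Fin 2) {z : E2} (hz : z ≠ 0) :
    Tendsto (fun r => gradKernel δ r i z) (𝓝[>] 0) (𝓝 (gradKernel δ 0 i z)) := by
  have : ContinuousAt (fun r : ℝ => gradKernel δ r i z) 0 :=
    continuousAt_const.mul (continuousAt_const.div (by fun_prop) (by simpa using hz))
  exact this.tendsto.mono_left nhdsWithin_le_nhds

lemma smoothKernel_eq_zero {δ : ℝ} (hδ : 0 < δ) {z : E2} (hz : δ < ‖z‖) :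
    smoothKernel δ z = 0 := by
  rw [smoothKernel, deriv_cutoff_of_gt hδ (by gcongr), mul_zero]

lemma isTest_smoothKernel {δ : ℝ} (hδ : 0 < δ) : IsTest (smoothKernel δ) := by
  refine isTest_of_norm ?_ fun z => smoothKernel_eq_zero hδ
  have h : ContDiff ℝ (⊤ : ℕ∞) (deriv (cutoff δ)) :=
    (contDiff_infty_iff_deriv.1 (contDiff_cutoff δ)).2
  exact contDiff_const.mul (h.comp (contDiff_norm_sq ℝ))

lemma smoothKernel_eventually_zero {δ : ℝ} (hδ : 0 < δ) : smoothKernel δ =ᶠ[𝓝 0] 0 := by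
  have h : Tendsto (fun z : E2 => ‖z‖ ^ 2) (𝓝 0) (𝓝 0) := by
    have : Continuous fun z : E2 => ‖z‖ ^ 2 := by fun_prop
    simpa using this.tendsto 0
  filter_upwards [h.eventually (gt_mem_nhds (by positivity : (0:ℝ) < δ ^ 2 / 2))] with z hz
  rw [smoothKernel, deriv_cutoff_of_lt hδ hz, mul_zero]
  rfl

lemma IsTest.exists_bound {f : E2 → ℝ} (hf : IsTest f) : ∃ B, ∀ z, |f z| ≤ B :=
  hf.2.exists_bound_of_continuous hf.continuous

lemma exists_le_riesz {f : E2 → ℝ} (hf : IsTest f) (h0 : f 0 = 0)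
    (hs : tsupport f ⊆ closedBall 0 1) : ∃ K, 0 ≤ K ∧ ∀ z, |f z| ≤ K * riesz z := by
  obtain ⟨B, hB⟩ := hf.exists_bound
  have hB0 : 0 ≤ B := (abs_nonneg _).trans (hB 0)
  refine ⟨B, hB0, fun z => ?_⟩
  rcases eq_or_ne z 0 with rfl | hz
  · rw [h0, abs_zero]
    exact mul_nonneg hB0 (riesz_nonneg _)
  rcases le_or_gt ‖z‖ 1 with h | h
  · rw [riesz_of_norm_le_one h]
    refine (hB z).trans (le_mul_of_one_le_right hB0 ?_)
    exact (one_le_inv₀ (norm_pos_iff.2 hz)).2 h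
  · have : z ∉ tsupport f := fun h' => by
      have := hs h'
      simp only [mem_closedBall, dist_zero_right] at this
      linarith
    rw [image_eq_zero_of_notMem_tsupport this, abs_zero]
    exact mul_nonneg hB0 (riesz_nonneg _)

lemma tsupport_smoothKernel {δ : ℝ} (hδ : 0 < δ) (hδ1 : δ ≤ 1) :
    tsupport (smoothKernel δ) ⊆ closedBall 0 1 :=
  (tsupport_subset_closedBall fun _ => smoothKernel_eq_zero hδ).trans
    (closedBall_subset_closedBall hδ1)

lemma exists_smoothKernel_le {δ : ℝ} (hδ : 0 < δ) (hδ1 : δ ≤ 1) :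
    ∃ K, 0 ≤ K ∧ ∀ z, |smoothKernel δ z| ≤ K * riesz z :=
  exists_le_riesz (isTest_smoothKernel hδ) (smoothKernel_eventually_zero hδ).eq_of_nhds
    (tsupport_smoothKernel hδ hδ1)

lemma exists_pd_smoothKernel_le {δ : ℝ} (hδ : 0 < δ) (hδ1 : δ ≤ 1) (i : Fin 2) :
    ∃ K, 0 ≤ K ∧ ∀ z, |pd i (smoothKernel δ) z| ≤ K * riesz z := by
  refine exists_le_riesz ((isTest_smoothKernel hδ).pd i) ?_
    ((tsupport_pd_subset _ i).trans (tsupport_smoothKernel hδ hδ1))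
  rw [pd, (smoothKernel_eventually_zero hδ).fderiv_eq]
  simp

lemma abs_remKernel_le (δ r : ℝ) (z : E2) : |remKernel δ r z| ≤ |smoothKernel δ z| := by
  rw [remKernel, smoothKernel, abs_mul]
  refine mul_le_of_le_one_right (abs_nonneg _) ?_
  rw [abs_of_nonneg (by positivity)]
  refine div_le_one_of_le₀ ?_ (by positivity)
  nlinarith [sq_nonneg r]

lemma tendsto_remKernel (δ : ℝ) {z : E2} (hz : z ≠ 0) :
    Tendsto (fun r => remKernel δ r z) (𝓝[>] 0) (𝓝 (smoothKernel δ z)) := by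
  have : ContinuousAt (fun r : ℝ => remKernel δ r z) 0 :=
    continuousAt_const.mul (continuousAt_const.div (by fun_prop) (by simpa using hz))
  have h2 : remKernel δ 0 z = smoothKernel δ z := by
    simp [remKernel, smoothKernel, hz]
  rw [← h2]
  exact this.tendsto.mono_left nhdsWithin_le_nhds

lemma measurable_remKernel (δ r : ℝ) : Measurable (remKernel δ r) := by
  have h2 : Measurable fun z : E2 => deriv (cutoff δ) (‖z‖ ^ 2) :=
    (measurable_deriv _).comp (by fun_prop)
  exact (h2.const_mul 4).mul (by fun_prop)

lemma integrable_mass : Integrable (fun s : E2 => 4 / (‖s‖ ^ 2 + 1) ^ 2) volume := by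
  have := (integrable_rpow_neg_one_add_norm_sq (E := E2) (μ := volume) (r := 4)
    (by simp; norm_num)).const_mul 4
  refine this.congr (Eventually.of_forall fun s => ?_)
  have h : (-4 / 2 : ℝ) = -(2:ℕ) := by norm_num
  simp only
  rw [h, Real.rpow_neg (by positivity), Real.rpow_natCast, add_comm, div_eq_mul_inv]

/-- The total mass of the Laplacian of `log (‖z‖ ^ 2)`. -/
def logMass : ℝ := ∫ s : E2, 4 / (‖s‖ ^ 2 + 1) ^ 2

lemma logMass_pos : 0 < logMass := by
  refine (integral_pos_iff_support_of_nonneg (fun s => by positivity) integrable_mass).2 ?_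
  have : Function.support (fun s : E2 => 4 / (‖s‖ ^ 2 + 1) ^ 2) = univ :=
    eq_univ_of_forall fun s => by
      simp only [Function.mem_support]
      positivity
  rw [this]
  simp

lemma conv_massKernel {δ r : ℝ} (hr : 0 < r) (ψ : E2 → ℝ) (y : E2) :
    conv (massKernel δ r) ψ y =
      ∫ s, 4 / (‖s‖ ^ 2 + 1) ^ 2 * (cutoff δ (r ^ 2 * ‖s‖ ^ 2) * ψ (y - r • s)) := by
  have h := Measure.integral_comp_smul volume (fun x => massKernel δ r x * ψ (y - x)) r
  rw [conv_apply']
  have hf : Module.finrank ℝ E2 = 2 := by simp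
  rw [hf, abs_of_nonneg (by positivity), smul_eq_mul, eq_comm, inv_mul_eq_div,
    div_eq_iff (by positivity)] at h
  rw [h, mul_comm, ← integral_const_mul]
  refine integral_congr_ae (Eventually.of_forall fun s => ?_)
  simp only [massKernel, norm_smul, Real.norm_of_nonneg hr.le, mul_pow]
  have : r ^ 2 * ‖s‖ ^ 2 + r ^ 2 = r ^ 2 * (‖s‖ ^ 2 + 1) := by ring
  rw [this]
  field_simp

lemma abs_conv_massKernel_le {δ r B : ℝ} (hr : 0 < r) {ψ : E2 → ℝ} (hB : ∀ z, |ψ z| ≤ B) (y : E2) :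
    |conv (massKernel δ r) ψ y| ≤ logMass * B := by
  rw [conv_massKernel hr, ← Real.norm_eq_abs, logMass, ← integral_mul_const]
  refine norm_integral_le_of_norm_le (integrable_mass.mul_const B)
    (Eventually.of_forall fun s => ?_)
  rw [norm_mul, norm_mul, Real.norm_of_nonneg (by positivity)]
  gcongr
  calc ‖cutoff δ (r ^ 2 * ‖s‖ ^ 2)‖ * ‖ψ (y - r • s)‖ ≤ 1 * B := by
        gcongr
        · exact abs_cutoff_le_one _ _
        · exact hB _
    _ = B := one_mul B

lemma tendsto_conv_massKernel {δ B : ℝ} (hδ : 0 < δ) {ψ : E2 → ℝ} (hψ : Continuous ψ)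
    (hB : ∀ z, |ψ z| ≤ B) (y : E2) :
    Tendsto (fun r => conv (massKernel δ r) ψ y) (𝓝[>] 0) (𝓝 (logMass * ψ y)) := by
  have hc := (contDiff_cutoff δ).continuous
  have h : Tendsto (fun r : ℝ => ∫ s : E2, 4 / (‖s‖ ^ 2 + 1) ^ 2 *
      (cutoff δ (r ^ 2 * ‖s‖ ^ 2) * ψ (y - r • s))) (𝓝[>] 0) (𝓝 (logMass * ψ y)) := by
    rw [logMass, ← integral_mul_const]
    refine tendsto_integral_filter_of_dominated_convergence
      (fun s => 4 / (‖s‖ ^ 2 + 1) ^ 2 * (1 * B)) ?_ ?_ (integrable_mass.mul_const _) ?_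
    · refine Eventually.of_forall fun r => integrable_mass.1.mul ?_
      exact (by fun_prop : Continuous fun s : E2 =>
        cutoff δ (r ^ 2 * ‖s‖ ^ 2) * ψ (y - r • s)).aestronglyMeasurable
    · refine Eventually.of_forall fun r => Eventually.of_forall fun s => ?_
      rw [norm_mul, norm_mul, Real.norm_of_nonneg (by positivity)]
      gcongr
      · exact abs_cutoff_le_one _ _
      · exact hB _
    · refine Eventually.of_forall fun s => ?_
      have : Continuous fun r : ℝ => 4 / (‖s‖ ^ 2 + 1) ^ 2 *
          (cutoff δ (r ^ 2 * ‖s‖ ^ 2) * ψ (y - r • s)) := by fun_prop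
      have h0 := this.tendsto 0
      simp only [ne_eq, OfNat.ofNat_ne_zero, not_false_eq_true, zero_pow, zero_mul, zero_smul,
        sub_zero, cutoff_eq_one hδ (by positivity : (0:ℝ) ≤ δ ^ 2 / 2), one_mul] at h0
      exact h0.mono_left nhdsWithin_le_nhds
  refine h.congr' ?_
  filter_upwards [eventually_pos] with r hr
  exact (conv_massKernel hr ψ y).symm

lemma conv_lap_regLog {δ r : ℝ} (hδ : 0 < δ) (hδ1 : δ ≤ 1) (hr : 0 < r) {ψ : E2 → ℝ}
    (hψ : IsTest ψ) (y : E2) :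
    conv (lap (regLog δ r)) ψ y = conv (massKernel δ r) ψ y + conv (remKernel δ r) ψ y := by
  obtain ⟨K, -, hK⟩ := exists_smoothKernel_le hδ hδ1
  obtain ⟨B, hB⟩ := hψ.exists_bound
  have hψc := hψ.continuous
  rw [lap_regLog hδ hr, conv_apply', conv_apply', conv_apply', ← integral_add]
  · simp_rw [add_mul]
  · have hc : Continuous (massKernel δ r) := by
      have := (contDiff_cutoff δ).continuous
      exact Continuous.div (by fun_prop) (by fun_prop) fun z => by positivity
    exact ((hψc.comp (continuous_const.sub continuous_id)).mul hc |>.integrable_of_hasCompactSupport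
      (by
        have h1 : HasCompactSupport fun x => ψ (y - x) :=
          hψ.2.comp_homeomorph (Homeomorph.subLeft y)
        exact h1.mul_right)).congr (Eventually.of_forall fun z => mul_comm _ _)
  · refine (integrable_of_le_riesz (measurable_remKernel δ r).aestronglyMeasurable
      (Eventually.of_forall fun z => (abs_remKernel_le δ r z).trans (hK z))).mul_bdd (c := B) ?_ ?_
    · exact (by fun_prop : Continuous fun x => ψ (y - x)).aestronglyMeasurable
    · exact Eventually.of_forall fun x => hB _

lemma IsTest.continuous_lap {f : E2 → ℝ} (hf : IsTest f) : Continuous (lap f) :=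
  continuous_finsetSum _ fun i _ => ((hf.pd i).pd i).continuous

/-- The combination of potentials of a measure `μ` and a function `u` on the unit disk that
represents the solution `u` of `-Δ u = μ` and its derivatives. -/
def repPot (g s : E2 → ℝ) (u : E2 → ℝ) (μ : SignedMeasure E2) (x : E2) : ℝ :=
  pot g 1 (μ.toJordanDecomposition.negPart.restrict (ball 0 1)) x -
    pot g 1 (μ.toJordanDecomposition.posPart.restrict (ball 0 1)) x -
    pot s u (volume.restrict (ball 0 1)) x

section Representation

variable {u : E2 → ℝ} {μ : SignedMeasure E2}

lemma integrable_repPot {g s : E2 → ℝ} (hg : Integrable g volume) (hs : Integrable s volume)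
    (hu : IntegrableOn u (ball 0 1)) : Integrable (repPot g s u μ) volume :=
  ((integrable_pot hg (integrable_const 1)).sub (integrable_pot hg (integrable_const 1))).sub
    (integrable_pot hs hu)

lemma integral_mul_repPot {g s : E2 → ℝ} (hg : Integrable g volume) (hs : Integrable s volume)
    (hu : IntegrableOn u (ball 0 1)) {φ : E2 → ℝ} (hφ : IsTest φ) :
    ∫ x, φ x * repPot g s u μ x =
      (∫ x in ball 0 1, conv g φ x ∂μ.toJordanDecomposition.negPart) -
        (∫ x in ball 0 1, conv g φ x ∂μ.toJordanDecomposition.posPart) -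
        ∫ x in ball 0 1, u x * conv s φ x := by
  obtain ⟨B, hB⟩ := hφ.exists_bound
  have hg' : ∀ ν : Measure E2, IsFiniteMeasure ν →
      ∫ x, conv g φ x ∂ν = ∫ x, φ x * pot g 1 ν x := fun ν _ => by
    simpa using integral_mul_conv (w := 1) (ν := ν) hg (integrable_const 1) hφ.continuous hB
  have hi : ∀ {f : E2 → ℝ}, Integrable f volume → Integrable (fun x => φ x * f x) volume :=
    fun hf => hf.bdd_mul hφ.continuous.aestronglyMeasurable (Eventually.of_forall hB)
  have h1 : ∀ ν : Measure E2, IsFiniteMeasure ν → Integrable (fun x => φ x * pot g 1 ν x) :=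
    fun ν _ => hi (integrable_pot hg (integrable_const 1))
  have h3 := hi (integrable_pot hs hu)
  simp only [repPot, mul_sub]
  rw [hg' _ inferInstance, hg' _ inferInstance, integral_mul_conv hs hu hφ.continuous hB,
    integral_sub ?_ h3, integral_sub (h1 _ inferInstance) (h1 _ inferInstance)]
  exact (h1 _ inferInstance).sub (h1 _ inferInstance)

lemma logMass_mul_integral {δ : ℝ} (hδ : 0 < δ) (hδ1 : δ ≤ 1) (h : WeakPoisson (ball 0 1) u μ)
    (hu : IntegrableOn u (ball 0 1)) {ψ : E2 → ℝ} (hψ : IsTest ψ)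
    (hψs : tsupport ψ ⊆ ball 0 (1 - δ)) :
    logMass * ∫ x in ball 0 1, u x * ψ x =
      (∫ x in ball 0 1, conv (logKernel δ) ψ x ∂μ.toJordanDecomposition.negPart) -
        (∫ x in ball 0 1, conv (logKernel δ) ψ x ∂μ.toJordanDecomposition.posPart) -
        ∫ x in ball 0 1, u x * conv (smoothKernel δ) ψ x := by
  obtain ⟨K, hK0, hK⟩ := exists_smoothKernel_le hδ hδ1
  obtain ⟨B, hB⟩ := hψ.exists_bound
  have hψc := hψ.continuous
  have hreg : ∀ r, ∀ᵐ z, |regLog δ r z| ≤ 2 * riesz z := fun r => by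
    filter_upwards [ae_ne_zero] with z hz using abs_regLog_le hδ hδ1 r hz
  have hrem : ∀ r, ∀ᵐ z, |remKernel δ r z| ≤ K * riesz z := fun r =>
    Eventually.of_forall fun z => (abs_remKernel_le δ r z).trans (hK z)
  have hlog : ∀ ν : Measure E2, IsFiniteMeasure ν →
      Tendsto (fun r => ∫ x, conv (regLog δ r) ψ x ∂ν) (𝓝[>] 0)
        (𝓝 (∫ x, conv (logKernel δ) ψ x ∂ν)) := fun ν _ => by
    have := tendsto_integral_mul_of_bounded (l := 𝓝[>] (0:ℝ)) (ν := ν)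
      (integrable_const (1:ℝ)) (a := fun r => conv (regLog δ r) ψ) (a₀ := conv (logKernel δ) ψ)
      (M := ∫ z, 2 * riesz z * B)
      (by filter_upwards [eventually_pos] with r hr
          exact ((isTest_regLog hδ hr).conv hψ).continuous)
      (Eventually.of_forall fun r y => abs_conv_le (hreg r) hB y)
      (fun y => tendsto_conv
        (by filter_upwards [eventually_pos] with r hr
            exact (contDiff_regLog hδ hr).continuous.aestronglyMeasurable)
        (Eventually.of_forall hreg)
        (by filter_upwards [ae_ne_zero] with z hz using tendsto_regLog hδ hz) hψc hB y)
    simpa using this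
  have hlap := tendsto_integral_mul_of_bounded (l := 𝓝[>] (0:ℝ)) hu
    (a := fun r => conv (lap (regLog δ r)) ψ)
    (a₀ := fun y => logMass * ψ y + conv (smoothKernel δ) ψ y)
    (M := logMass * B + ∫ z, K * riesz z * B)
    (by filter_upwards [eventually_pos] with r hr
        rw [← lap_conv (isTest_regLog hδ hr) hψ]
        exact ((isTest_regLog hδ hr).conv hψ).continuous_lap)
    (by filter_upwards [eventually_pos] with r hr y
        rw [conv_lap_regLog hδ hδ1 hr hψ]
        exact (abs_add_le _ _).trans
          (add_le_add (abs_conv_massKernel_le hr hB y) (abs_conv_le (hrem r) hB y)))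
    (fun y => by
      refine ((tendsto_conv_massKernel hδ hψc hB y).add (tendsto_conv
        (Eventually.of_forall fun r => (measurable_remKernel δ r).aestronglyMeasurable)
        (Eventually.of_forall hrem)
        (by filter_upwards [ae_ne_zero] with z hz using tendsto_remKernel δ hz)
        hψc hB y)).congr' ?_
      filter_upwards [eventually_pos] with r hr
      rw [conv_lap_regLog hδ hδ1 hr hψ])
  have hid := tendsto_nhds_unique_of_eventuallyEq hlap
    ((hlog (μ.toJordanDecomposition.negPart.restrict (ball 0 1)) inferInstance).sub
      (hlog (μ.toJordanDecomposition.posPart.restrict (ball 0 1)) inferInstance))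
    (by filter_upwards [eventually_pos] with r hr
        exact h.conv (isTest_regLog hδ hr) (tsupport_regLog hδ r) hψ hψs)
  have hs : Integrable (fun x => u x * conv (smoothKernel δ) ψ x)
      (volume.restrict (ball 0 1)) :=
    Integrable.mul_bdd (c := ∫ z, K * riesz z * B) hu
      ((isTest_smoothKernel hδ).conv hψ).continuous.aestronglyMeasurable
      (Eventually.of_forall fun y => abs_conv_le (Eventually.of_forall hK) hB y)
  have hm : Integrable (fun x => logMass * (u x * ψ x)) (volume.restrict (ball 0 1)) :=
    (Integrable.mul_bdd (c := B) hu hψc.aestronglyMeasurable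
      (Eventually.of_forall hB)).const_mul _
  rw [← hid, ← integral_const_mul, ← integral_sub ?_ hs]
  · congr 1 with x
    ring
  · refine (hm.add hs).congr (Eventually.of_forall fun x => ?_)
    simp only [Pi.add_apply]
    ring

lemma conv_logKernel_pd {δ : ℝ} (hδ : 0 < δ) (hδ1 : δ ≤ 1) {φ : E2 → ℝ} (hφ : IsTest φ)
    (i : Fin 2) : conv (logKernel δ) (pd i φ) = conv (gradKernel δ 0 i) φ := by
  funext y
  obtain ⟨B, hB⟩ := hφ.exists_bound
  obtain ⟨B', hB'⟩ := (hφ.pd i).exists_bound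
  refine tendsto_nhds_unique_of_eventuallyEq (l := 𝓝[>] (0:ℝ))
    (f := fun r => conv (regLog δ r) (pd i φ) y) (g := fun r => conv (gradKernel δ r i) φ y)
    (tendsto_conv (K := 2) ?_ ?_ ?_ (hφ.pd i).continuous hB' y)
    (tendsto_conv (K := 2) ?_ ?_ ?_ hφ.continuous hB y) ?_
  · filter_upwards [eventually_pos] with r hr
    exact (contDiff_regLog hδ hr).continuous.aestronglyMeasurable
  · filter_upwards with r
    filter_upwards [ae_ne_zero] with z hz using abs_regLog_le hδ hδ1 r hz
  · filter_upwards [ae_ne_zero] with z hz using tendsto_regLog hδ hz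
  · exact Eventually.of_forall fun r => (measurable_gradKernel δ r i).aestronglyMeasurable
  · exact Eventually.of_forall fun r => Eventually.of_forall (abs_gradKernel_le hδ hδ1 r i)
  · filter_upwards [ae_ne_zero] with z hz using tendsto_gradKernel δ i hz
  · filter_upwards [eventually_pos] with r hr
    rw [conv_pd_comm (isTest_regLog hδ hr) hφ, pd_regLog hδ hr]

/-- The representation of a solution, up to the factor `logMass`. -/
def solRepr (δ : ℝ) (u : E2 → ℝ) (μ : SignedMeasure E2) : E2 → ℝ :=
  repPot (logKernel δ) (smoothKernel δ) u μ

/-- The representation of the negative of the `i`-th derivative of a solution, up to the factor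
`logMass`. -/
def gradRepr (δ : ℝ) (i : Fin 2) (u : E2 → ℝ) (μ : SignedMeasure E2) : E2 → ℝ :=
  repPot (gradKernel δ 0 i) (pd i (smoothKernel δ)) u μ

lemma IsTest.integrable {f : E2 → ℝ} (hf : IsTest f) : Integrable f volume :=
  hf.continuous.integrable_of_hasCompactSupport hf.2

lemma integrable_logKernel {δ : ℝ} (hδ : 0 < δ) (hδ1 : δ ≤ 1) : Integrable (logKernel δ) volume :=
  integrable_of_le_riesz (aestronglyMeasurable_logKernel hδ)
    (Eventually.of_forall (abs_logKernel_le hδ hδ1))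

lemma integrable_gradKernel {δ : ℝ} (hδ : 0 < δ) (hδ1 : δ ≤ 1) (i : Fin 2) :
    Integrable (gradKernel δ 0 i) volume :=
  integrable_of_le_riesz (measurable_gradKernel δ 0 i).aestronglyMeasurable
    (Eventually.of_forall (abs_gradKernel_le hδ hδ1 0 i))

lemma integrable_solRepr {δ : ℝ} (hδ : 0 < δ) (hδ1 : δ ≤ 1) (hu : IntegrableOn u (ball 0 1)) :
    Integrable (solRepr δ u μ) volume :=
  integrable_repPot (integrable_logKernel hδ hδ1) (isTest_smoothKernel hδ).integrable hu

lemma integrable_gradRepr {δ : ℝ} (hδ : 0 < δ) (hδ1 : δ ≤ 1) (i : Fin 2)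
    (hu : IntegrableOn u (ball 0 1)) : Integrable (gradRepr δ i u μ) volume :=
  integrable_repPot (integrable_gradKernel hδ hδ1 i) ((isTest_smoothKernel hδ).pd i).integrable hu

lemma logMass_mul_integral_mul {δ : ℝ} (hδ : 0 < δ) (hδ1 : δ ≤ 1)
    (h : WeakPoisson (ball 0 1) u μ) (hu : IntegrableOn u (ball 0 1)) {φ : E2 → ℝ}
    (hφ : IsTest φ) (hφs : tsupport φ ⊆ ball 0 (1 - δ)) :
    logMass * ∫ x in ball 0 1, u x * φ x = ∫ x, φ x * solRepr δ u μ x := by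
  rw [solRepr, integral_mul_repPot (integrable_logKernel hδ hδ1)
    (isTest_smoothKernel hδ).integrable hu hφ, logMass_mul_integral hδ hδ1 h hu hφ hφs]

lemma logMass_mul_integral_mul_pd {δ : ℝ} (hδ : 0 < δ) (hδ1 : δ ≤ 1)
    (h : WeakPoisson (ball 0 1) u μ) (hu : IntegrableOn u (ball 0 1)) {φ : E2 → ℝ}
    (hφ : IsTest φ) (hφs : tsupport φ ⊆ ball 0 (1 - δ)) (i : Fin 2) :
    logMass * ∫ x in ball 0 1, u x * pd i φ x = ∫ x, φ x * gradRepr δ i u μ x := by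
  rw [gradRepr, integral_mul_repPot (integrable_gradKernel hδ hδ1 i)
    ((isTest_smoothKernel hδ).pd i).integrable hu hφ, logMass_mul_integral hδ hδ1 h hu (hφ.pd i)
    ((tsupport_pd_subset φ i).trans hφs), conv_logKernel_pd hδ hδ1 hφ,
    conv_pd_comm (isTest_smoothKernel hδ) hφ]

end Representation

section Bounds

variable {u : E2 → ℝ} {μ : SignedMeasure E2}

/-- The finite measure on the unit disk that controls the potentials in `repPot`. -/
def sourceMeasure (u : E2 → ℝ) (μ : SignedMeasure E2) : Measure E2 :=
  (volume.restrict (ball 0 1)).withDensity (fun y => ‖u y‖ₑ) + (tv μ).restrict (ball 0 1)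

lemma sourceMeasure_univ (hu : IntegrableOn u (ball 0 1)) :
    sourceMeasure u μ univ =
      ENNReal.ofReal ((∫ x in ball (0:E2) 1, |u x|) + (tv μ (ball (0:E2) 1)).toReal) := by
  have : tv μ (ball 0 1) ≠ ∞ := by
    unfold tv
    exact measure_ne_top _ _
  rw [ENNReal.ofReal_add (by positivity) ENNReal.toReal_nonneg, ENNReal.ofReal_toReal this,
    sourceMeasure, Measure.add_apply, withDensity_apply _ MeasurableSet.univ,
    Measure.restrict_apply_univ, Measure.restrict_univ]
  congr 1
  exact (ofReal_integral_norm_eq_lintegral_enorm hu).symm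

lemma isFiniteMeasure_sourceMeasure (hu : IntegrableOn u (ball 0 1)) :
    IsFiniteMeasure (sourceMeasure u μ) :=
  ⟨by simp [sourceMeasure_univ hu]⟩

lemma enorm_repPot_le {g s : E2 → ℝ} {K : ℝ} (hK : 0 ≤ K) (hg : ∀ z, |g z| ≤ K * riesz z)
    (hs : ∀ z, |s z| ≤ K * riesz z) (hu : IntegrableOn u (ball 0 1)) (x : E2) :
    ‖repPot g s u μ x‖ₑ ≤
      ENNReal.ofReal K * ∫⁻ y, ENNReal.ofReal (riesz (y - x)) ∂(sourceMeasure u μ) := by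
  have hm : Measurable fun y => ENNReal.ofReal (riesz (y - x)) :=
    (measurable_riesz.comp (measurable_id.sub_const x)).ennreal_ofReal
  have hν := fun ν => enorm_pot_le (w := 1) (ν := ν) hK hg x
  simp only [Pi.one_apply, enorm_one, one_mul] at hν
  rw [sourceMeasure, tv, SignedMeasure.totalVariation, Measure.restrict_add,
    lintegral_add_measure, lintegral_add_measure,
    lintegral_withDensity_eq_lintegral_mul₀ hu.1.enorm hm.aemeasurable, repPot, mul_add, mul_add,
    add_comm, add_comm (ENNReal.ofReal K * _)]
  exact enorm_sub_le.trans (add_le_add (enorm_sub_le.trans (add_le_add (hν _) (hν _)))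
    (enorm_pot_le hK hs x))

lemma integrableOn_rpow_of_enorm_le {F : Type*} [NormedAddCommGroup F] {f : E2 → F} {s : Set E2}
    {q A : ℝ} (hq : q ∈ Ico (1:ℝ) 2) (hA : 0 ≤ A) (hu : IntegrableOn u (ball 0 1))
    (hf : AEStronglyMeasurable f (volume.restrict s))
    (hb : ∀ᵐ x ∂volume.restrict s, ‖f x‖ₑ ≤
      ENNReal.ofReal A * ∫⁻ y, ENNReal.ofReal (riesz (y - x)) ∂(sourceMeasure u μ)) :
    IntegrableOn (fun x => ‖f x‖ ^ q) s ∧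
      (∫ x in s, ‖f x‖ ^ q) ^ (1 / q) ≤ A * (∫ z, riesz z ^ q) ^ (1 / q) *
        ((∫ x in ball (0:E2) 1, |u x|) + (tv μ (ball (0:E2) 1)).toReal) := by
  have hq0 : 0 < q := by linarith [hq.1]
  have := isFiniteMeasure_sourceMeasure (μ := μ) hu
  set M := (∫ x in ball (0:E2) 1, |u x|) + (tv μ (ball (0:E2) 1)).toReal with hM
  have hM0 : 0 ≤ M := by positivity
  set R := ∫ z, riesz z ^ q with hR
  have hrn : ∀ z, 0 ≤ riesz z ^ q := fun z => Real.rpow_nonneg (riesz_nonneg z) q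
  have hR0 : 0 ≤ R := integral_nonneg hrn
  have hRe : ∫⁻ z, ENNReal.ofReal (riesz z) ^ q = ENNReal.ofReal R := by
    rw [hR, ofReal_integral_eq_lintegral_ofReal (integrable_riesz_rpow hq)
      (Eventually.of_forall hrn)]
    simp_rw [ENNReal.ofReal_rpow_of_nonneg (riesz_nonneg _) hq0.le]
  have he : ∀ x, ‖‖f x‖ ^ q‖ₑ = ‖f x‖ₑ ^ q := fun x => by
    rw [Real.enorm_eq_ofReal (by positivity), ← ENNReal.ofReal_rpow_of_nonneg (norm_nonneg _) hq0.le,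
      ofReal_norm]
  have hle : ∫⁻ x in s, ‖f x‖ₑ ^ q ≤ ENNReal.ofReal ((A * M) ^ q * R) := by
    calc ∫⁻ x in s, ‖f x‖ₑ ^ q
        ≤ ∫⁻ x in s, ENNReal.ofReal A ^ q *
            (∫⁻ y, ENNReal.ofReal (riesz (y - x)) ∂(sourceMeasure u μ)) ^ q := by
          refine lintegral_mono_ae ?_
          filter_upwards [hb] with x hx
          rw [← ENNReal.mul_rpow_of_nonneg _ _ hq0.le]
          gcongr
      _ ≤ ∫⁻ x, ENNReal.ofReal A ^ q *
            (∫⁻ y, ENNReal.ofReal (riesz (y - x)) ∂(sourceMeasure u μ)) ^ q :=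
          setLIntegral_le_lintegral _ _
      _ ≤ ENNReal.ofReal A ^ q * (ENNReal.ofReal M ^ q * ENNReal.ofReal R) := by
          rw [lintegral_const_mul' _ _ (by simp [hq0.le]), ← hRe, hM, ← sourceMeasure_univ hu]
          gcongr
          exact lintegral_riesz_pot_rpow_le _ hq.1
      _ = ENNReal.ofReal ((A * M) ^ q * R) := by
          rw [ENNReal.ofReal_rpow_of_nonneg hA hq0.le, ENNReal.ofReal_rpow_of_nonneg hM0 hq0.le,
            ← ENNReal.ofReal_mul (by positivity), ← ENNReal.ofReal_mul (by positivity),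
            Real.mul_rpow hA hM0, mul_assoc]
  refine ⟨⟨(hf.norm.aemeasurable.pow_const q).aestronglyMeasurable, ?_⟩, ?_⟩
  · rw [hasFiniteIntegral_iff_enorm]
    simp_rw [he]
    exact hle.trans_lt ENNReal.ofReal_lt_top
  · have h1 : ∫ x in s, ‖f x‖ ^ q ≤ (A * M) ^ q * R := by
      refine (le_abs_self _).trans ?_
      rw [← Real.norm_eq_abs, ← ENNReal.ofReal_le_ofReal_iff (by positivity), ofReal_norm]
      refine (enorm_integral_le_lintegral_enorm _).trans ?_
      simp_rw [he]
      exact hle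
    calc (∫ x in s, ‖f x‖ ^ q) ^ (1 / q) ≤ ((A * M) ^ q * R) ^ (1 / q) :=
          Real.rpow_le_rpow (integral_nonneg fun x => by positivity) h1 (by positivity)
      _ = A * R ^ (1 / q) * M := by
          rw [Real.mul_rpow (by positivity) hR0, one_div,
            Real.rpow_rpow_inv (by positivity) hq0.ne']
          ring

/-- The weak gradient of a solution on `ball 0 (1 - δ)`. -/
def gradVec (δ : ℝ) (u : E2 → ℝ) (μ : SignedMeasure E2) (x : E2) : E2 :=
  WithLp.toLp 2 fun i => -(logMass⁻¹ * gradRepr δ i u μ x)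

lemma integrable_gradVec {δ : ℝ} (hδ : 0 < δ) (hδ1 : δ ≤ 1) (i : Fin 2)
    (hu : IntegrableOn u (ball 0 1)) : Integrable (fun x => gradVec δ u μ x i) volume :=
  ((integrable_gradRepr hδ hδ1 i hu).const_mul _).neg

lemma aestronglyMeasurable_gradVec {δ : ℝ} (hδ : 0 < δ) (hδ1 : δ ≤ 1)
    (hu : IntegrableOn u (ball 0 1)) : AEStronglyMeasurable (gradVec δ u μ) volume :=
  ((PiLp.continuous_toLp 2 _).measurable.comp_aemeasurable (aemeasurable_pi_lambda _ fun i =>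
    (integrable_gradVec hδ hδ1 i hu).aemeasurable)).aestronglyMeasurable

lemma enorm_gradVec_le {δ : ℝ} (hδ : 0 < δ) (hδ1 : δ ≤ 1) : ∃ A, 0 ≤ A ∧
    ∀ (u : E2 → ℝ) (μ : SignedMeasure E2), IntegrableOn u (ball 0 1) → ∀ x,
      ‖gradVec δ u μ x‖ₑ ≤
        ENNReal.ofReal A * ∫⁻ y, ENNReal.ofReal (riesz (y - x)) ∂(sourceMeasure u μ) := by
  choose K hK0 hK using exists_pd_smoothKernel_le hδ hδ1
  have hL := logMass_pos
  have hK1 : ∀ i, 0 ≤ max 2 (K i) := fun i => zero_le_two.trans (le_max_left _ _)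
  refine ⟨∑ i, logMass⁻¹ * max 2 (K i),
    Finset.sum_nonneg fun i _ => mul_nonneg (by positivity) (hK1 i), fun u μ hu x => ?_⟩
  rw [ENNReal.ofReal_sum_of_nonneg fun i _ => mul_nonneg (by positivity) (hK1 i), Finset.sum_mul]
  have h1 : ‖gradVec δ u μ x‖ₑ ≤ ∑ i, ‖gradVec δ u μ x i‖ₑ := by
    have h : gradVec δ u μ x = ∑ i, EuclideanSpace.single i (gradVec δ u μ x i) := by
      ext j
      fin_cases j <;> simp
    conv_lhs => rw [h]
    refine (enorm_sum_le _ _).trans (Finset.sum_le_sum fun i _ => ?_)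
    rw [← ofReal_norm, ← ofReal_norm, PiLp.norm_single]
  refine h1.trans (Finset.sum_le_sum fun i _ => ?_)
  have h2 : ‖gradRepr δ i u μ x‖ₑ ≤ ENNReal.ofReal (max 2 (K i)) *
      ∫⁻ y, ENNReal.ofReal (riesz (y - x)) ∂(sourceMeasure u μ) :=
    enorm_repPot_le (hK1 i)
      (fun z => (abs_gradKernel_le hδ hδ1 0 i z).trans
        (mul_le_mul_of_nonneg_right (le_max_left _ _) (riesz_nonneg z)))
      (fun z => (hK i z).trans (mul_le_mul_of_nonneg_right (le_max_right _ _) (riesz_nonneg z)))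
      hu x
  rw [ENNReal.ofReal_mul (by positivity), mul_assoc]
  simp only [gradVec, enorm_neg, enorm_mul]
  rw [Real.enorm_eq_ofReal (by positivity : (0:ℝ) ≤ logMass⁻¹)]
  gcongr

lemma enorm_solRepr_le {δ : ℝ} (hδ : 0 < δ) (hδ1 : δ ≤ 1) : ∃ A, 0 ≤ A ∧
    ∀ (u : E2 → ℝ) (μ : SignedMeasure E2), IntegrableOn u (ball 0 1) → ∀ x,
      ‖solRepr δ u μ x‖ₑ ≤
        ENNReal.ofReal A * ∫⁻ y, ENNReal.ofReal (riesz (y - x)) ∂(sourceMeasure u μ) := by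
  obtain ⟨K, hK0, hK⟩ := exists_smoothKernel_le hδ hδ1
  exact ⟨max 2 K, zero_le_two.trans (le_max_left _ _), fun u μ hu x => enorm_repPot_le
    (zero_le_two.trans (le_max_left _ _))
    (fun z => (abs_logKernel_le hδ hδ1 z).trans
      (mul_le_mul_of_nonneg_right (le_max_left _ _) (riesz_nonneg z)))
    (fun z => (hK z).trans (mul_le_mul_of_nonneg_right (le_max_right _ _) (riesz_nonneg z)))
    hu x⟩

end Bounds

section Solutions

variable {u : E2 → ℝ} {μ : SignedMeasure E2}

lemma IsTest.integrable_mul {φ : E2 → ℝ} (hφ : IsTest φ) {f : E2 → ℝ} {ν : Measure E2}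
    (hf : Integrable f ν) : Integrable (fun x => φ x * f x) ν := by
  obtain ⟨B, hB⟩ := hφ.exists_bound
  exact hf.bdd_mul hφ.continuous.aestronglyMeasurable (Eventually.of_forall hB)

lemma ae_logMass_mul_eq {δ : ℝ} (hδ : 0 < δ) (hδ1 : δ ≤ 1) (h : WeakPoisson (ball 0 1) u μ)
    (hu : IntegrableOn u (ball 0 1)) :
    ∀ᵐ x ∂volume.restrict (ball 0 (1 - δ)), u x = logMass⁻¹ * solRepr δ u μ x := by
  have hr : Integrable (solRepr δ u μ) (volume.restrict (ball 0 1)) :=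
    (integrable_solRepr hδ hδ1 hu).restrict
  have hsub : ball (0:E2) (1 - δ) ⊆ ball 0 1 := ball_subset_ball (by linarith)
  have hfi : Integrable (fun x => logMass * u x - solRepr δ u μ x)
    (volume.restrict (ball 0 1)) := (hu.const_mul logMass).sub hr
  have key := (isOpen_ball (x := (0:E2)) (ε := 1 - δ)).ae_eq_zero_of_integral_contDiff_smul_eq_zero
    (hfi.locallyIntegrable.locallyIntegrableOn _) fun φ hφ hφc hφs => by
      have ht : IsTest φ := ⟨hφ, hφc⟩
      have h1 := logMass_mul_integral_mul hδ hδ1 h hu ht hφs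
      have hs : tsupport (fun x => φ x * solRepr δ u μ x) ⊆ ball 0 1 :=
        (tsupport_mul_subset_left).trans (hφs.trans hsub)
      rw [← setIntegral_of_tsupport_subset hs, ← integral_const_mul] at h1
      simp only [smul_eq_mul, mul_sub]
      rw [integral_sub (ht.integrable_mul (hu.const_mul logMass)) (ht.integrable_mul hr), ← h1,
        sub_eq_zero]
      congr 1 with x
      ring
  rw [ae_restrict_iff' measurableSet_ball] at key ⊢
  filter_upwards [key] with x hx hxs
  have hL := logMass_pos
  rw [eq_inv_mul_iff_mul_eq₀ hL.ne']
  linarith [hx (hsub hxs) hxs]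

lemma integral_mul_pd_eq {δ : ℝ} (hδ : 0 < δ) (hδ1 : δ ≤ 1)
    (h : WeakPoisson (ball 0 1) u μ) (hu : IntegrableOn u (ball 0 1)) {φ : E2 → ℝ}
    (hφ : IsTest φ) (hφs : tsupport φ ⊆ ball 0 (1 - δ)) (i : Fin 2) :
    ∫ x in ball 0 1, u x * pd i φ x = -∫ x, φ x * gradVec δ u μ x i := by
  have hL := logMass_pos
  rw [← mul_right_inj' hL.ne', logMass_mul_integral_mul_pd hδ hδ1 h hu hφ hφs, ← integral_neg,
    ← integral_const_mul]
  congr 1 with x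
  simp only [gradVec]
  field_simp

lemma gradVec_ae_eq {δ ε : ℝ} (hδ : 0 < δ) (hδ1 : δ ≤ 1) (hε : 0 < ε) (hεδ : ε ≤ δ)
    (h : WeakPoisson (ball 0 1) u μ) (hu : IntegrableOn u (ball 0 1)) :
    ∀ᵐ x, x ∈ ball 0 (1 - δ) → gradVec δ u μ x = gradVec ε u μ x := by
  have hε1 := hεδ.trans hδ1
  have key : ∀ i, ∀ᵐ x, x ∈ ball 0 (1 - δ) → gradVec δ u μ x i - gradVec ε u μ x i = 0 := by
    intro i
    have h1 := integrable_gradVec (μ := μ) hδ hδ1 i hu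
    have h2 := integrable_gradVec (μ := μ) hε hε1 i hu
    refine isOpen_ball.ae_eq_zero_of_integral_contDiff_smul_eq_zero
      ((h1.sub h2).locallyIntegrable.locallyIntegrableOn _) fun φ hφ hφc hφs => ?_
    have ht : IsTest φ := ⟨hφ, hφc⟩
    have e1 := integral_mul_pd_eq hδ hδ1 h hu ht hφs i
    rw [integral_mul_pd_eq hε hε1 h hu ht (hφs.trans (ball_subset_ball (by linarith))) i] at e1
    simp only [smul_eq_mul, mul_sub]
    rw [integral_sub (ht.integrable_mul h1) (ht.integrable_mul h2)]
    linarith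
  filter_upwards [ae_all_iff.2 key] with x hx hxs
  ext i
  linarith [hx i hxs]

/-- The balls `ball 0 (1 - defect n)` exhaust the unit disk. -/
def defect (n : ℕ) : ℝ := 1 / ((n:ℝ) + 2)

lemma defect_pos (n : ℕ) : 0 < defect n := by
  unfold defect
  positivity

lemma defect_anti : Antitone defect := fun m n h => by
  unfold defect
  gcongr

lemma defect_zero : defect 0 = 1 / 2 := by
  simp [defect]

lemma defect_le_one (n : ℕ) : defect n ≤ 1 :=
  (defect_anti (Nat.zero_le n)).trans (by norm_num [defect_zero])

lemma exists_defect_lt {t : ℝ} (ht : 0 < t) : ∃ n, defect n < t := by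
  obtain ⟨n, hn⟩ := exists_nat_one_div_lt ht
  refine ⟨n, lt_of_le_of_lt ?_ hn⟩
  unfold defect
  gcongr
  norm_num

/-- The weak gradient of a solution on the unit disk. -/
def solGrad (u : E2 → ℝ) (μ : SignedMeasure E2) (x : E2) : E2 :=
  gradVec (defect (sInf {n | x ∈ ball 0 (1 - defect n)})) u μ x

lemma solGrad_eq_of_mem {x : E2} (hx : x ∈ ball 0 (1 / 2)) :
    solGrad u μ x = gradVec (1 / 2) u μ x := by
  have h : sInf {n | x ∈ ball (0:E2) (1 - defect n)} = 0 :=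
    Nat.sInf_eq_zero.2 (Or.inl (by
      rw [mem_ofPred_eq, defect_zero]
      norm_num at hx ⊢
      exact hx))
  rw [solGrad, h, defect_zero]

lemma solGrad_ae_eq (h : WeakPoisson (ball 0 1) u μ) (hu : IntegrableOn u (ball 0 1)) (n : ℕ) :
    ∀ᵐ x, x ∈ ball 0 (1 - defect n) → solGrad u μ x = gradVec (defect n) u μ x := by
  have key : ∀ m : ℕ, ∀ᵐ x, m ≤ n → x ∈ ball 0 (1 - defect m) →
      gradVec (defect m) u μ x = gradVec (defect n) u μ x := fun m => by
    by_cases hmn : m ≤ n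
    · filter_upwards [gradVec_ae_eq (defect_pos m) (defect_le_one m) (defect_pos n)
        (defect_anti hmn) h hu] with x hx _ using hx
    · exact Eventually.of_forall fun x hx => absurd hx hmn
  filter_upwards [ae_all_iff.2 key] with x hx hxs
  exact hx _ (Nat.sInf_le hxs) (Nat.sInf_mem (s := {n | x ∈ ball 0 (1 - defect n)}) ⟨n, hxs⟩)

lemma isWeakGrad_solGrad (h : WeakPoisson (ball 0 1) u μ) (hu : IntegrableOn u (ball 0 1)) :
    IsWeakGrad (ball 0 1) u (solGrad u μ) := by
  intro φ hφ hφs i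
  obtain ⟨r, hr, hrs⟩ := exists_lt_subset_ball (isClosed_tsupport φ) hφs
  obtain ⟨n, hn⟩ := exists_defect_lt (sub_pos.2 hr)
  have hφn : tsupport φ ⊆ ball 0 (1 - defect n) := hrs.trans (ball_subset_ball (by linarith))
  refine (integral_mul_pd_eq (defect_pos n) (defect_le_one n) h hu hφ hφn i).trans ?_
  rw [setIntegral_of_tsupport_subset (tsupport_mul_subset_left.trans hφs)]
  congr 1
  refine integral_congr_ae ?_
  filter_upwards [solGrad_ae_eq h hu n] with x hx
  by_cases hxs : x ∈ tsupport φ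
  · rw [hx (hφn hxs)]
  · rw [image_eq_zero_of_notMem_tsupport hxs, zero_mul, zero_mul]

end Solutions

/-- **Corollary 2.3, part 1.** `W^{1,q}` regularity on the half disk with the gradient
estimate `‖∇u‖_{L^q(D_{1/2})} ≤ C(q)(‖u‖_{L¹(D)} + |μ|(D))`. -/
theorem weak_solution_W1q_half_disk :
    ∀ q ∈ Set.Ico (1:ℝ) 2, ∃ C : ℝ, 0 < C ∧
      ∀ (τ γ : ℝ) (μ : SignedMeasure E2) (u : E2 → ℝ),
        IntegrableOn u (ball (0:E2) 1) volume →
        WeakPoisson (ball (0:E2) 1) u μ →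
        tv μ (ball (0:E2) 1) < ENNReal.ofReal τ →
        (∫ x in ball (0:E2) 1, |u x|) < γ →
        ∃ du : E2 → E2,
          IsWeakGrad (ball (0:E2) 1) u du ∧
          IntegrableOn (fun x => |u x| ^ q) (ball (0:E2) (1/2)) volume ∧
          IntegrableOn (fun x => ‖du x‖ ^ q) (ball (0:E2) (1/2)) volume ∧
          (∫ x in ball (0:E2) (1/2), ‖du x‖ ^ q) ^ (1/q)
            ≤ C * ((∫ x in ball (0:E2) 1, |u x|) + (tv μ (ball (0:E2) 1)).toReal) := by
  intro q hq
  obtain ⟨A, hA, hAb⟩ := enorm_gradVec_le (δ := 1 / 2) (by norm_num) (by norm_num)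
  obtain ⟨A', hA', hAb'⟩ := enorm_solRepr_le (δ := 1 / 2) (by norm_num) (by norm_num)
  have hR : 0 ≤ (∫ z, riesz z ^ q) ^ (1 / q) :=
    Real.rpow_nonneg (integral_nonneg fun z => Real.rpow_nonneg (riesz_nonneg z) q) _
  refine ⟨A * (∫ z, riesz z ^ q) ^ (1 / q) + 1, by positivity,
    fun τ γ μ u hu h _ _ => ⟨solGrad u μ, isWeakGrad_solGrad h hu, ?_, ?_⟩⟩
  · have hL := logMass_pos
    have hhalf : (1 - 1 / 2 : ℝ) = 1 / 2 := by norm_num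
    have hae := ae_logMass_mul_eq (δ := 1 / 2) (by norm_num) (by norm_num) h hu
    rw [hhalf] at hae
    refine (integrableOn_rpow_of_enorm_le (μ := μ) (A := logMass⁻¹ * A') hq (by positivity) hu
      (hu.mono_set (ball_subset_ball (by norm_num))).1 ?_).1
    filter_upwards [hae] with x hx
    rw [hx, enorm_mul, Real.enorm_eq_ofReal (by positivity : (0:ℝ) ≤ logMass⁻¹),
      ENNReal.ofReal_mul (by positivity), mul_assoc]
    gcongr
    exact hAb' u μ hu x
  · have hm : AEStronglyMeasurable (solGrad u μ) (volume.restrict (ball 0 (1 / 2))) :=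
      (aestronglyMeasurable_gradVec (δ := 1 / 2) (by norm_num) (by norm_num) hu).restrict.congr
        ((ae_restrict_mem measurableSet_ball).mono fun x hx => (solGrad_eq_of_mem hx).symm)
    have hmain := integrableOn_rpow_of_enorm_le (μ := μ) hq hA hu hm <| by
      filter_upwards [ae_restrict_mem measurableSet_ball] with x hx
      rw [solGrad_eq_of_mem hx]
      exact hAb u μ hu x
    refine ⟨hmain.1, hmain.2.trans ?_⟩
    gcongr
    linarith
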